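/- For all integers 1 ≤ ℓ < k and all γ, ε > 0 there exist δ > 0 and n₀ = n₀(γ,ε,k,ℓ) such that the following holds. If 𝓗 is a k-uniform hypergraph on n ≥ n₀ vertices such that all but at most δ·binom(n,ℓ) of the ℓ-element subsets S ⊆ V(𝓗) satisfy deg_𝓗(S) ≥ (δ⁺_{ℓ,k} + ε/2)·binom(n, k−ℓ), then 𝓗 contains a matching covering at least (1 − γ)·n vertices. -/

import Mathlib

open Finset

/-- A matching `M` of the hypergraph `H` (on vertex set `Fin n`) which is perfect. -/
def HyperPM {n : ℕ} (H M : Finset (Finset (Fin n))) : Prop :=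
  M ⊆ H ∧ (M : Set (Finset (Fin n))).PairwiseDisjoint id ∧ M.biUnion id = Finset.univ

/-- The degree of a vertex set `S` in the hypergraph `H`: the number of hyperedges containing `S`. -/
def hDeg {n : ℕ} (H : Finset (Finset (Fin n))) (S : Finset (Fin n)) : ℕ :=
  (H.filter (fun h => S ⊆ h)).card

/-- `t(n,k,ℓ)`: the smallest `d` such that every `n`-vertex `k`-uniform hypergraph with
minimum `ℓ`-degree at least `d` contains a perfect matching. -/
noncomputable def diracT (n k l : ℕ) : ℕ :=
  sInf {d : ℕ | ∀ H : Finset (Finset (Fin n)), (∀ e ∈ H, e.card = k) →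
    (∀ S : Finset (Fin n), S.card = l → d ≤ hDeg H S) → ∃ M, HyperPM H M}

/-- The `ℓ`-degree Dirac threshold `δ⁺_{ℓ,k} = lim_{n → ∞, k ∣ n} t(n,k,ℓ)/C(n,k-ℓ)`
(the limit is known to exist, so it equals the limsup along that filter). -/
noncomputable def diracThreshold (k l : ℕ) : ℝ :=
  Filter.limsup (fun n : ℕ => (diracT n k l : ℝ) / (n.choose (k - l)))
    (Filter.atTop ⊓ Filter.principal {n | k ∣ n})

/-- Hoeffding-type bound for the uniform distribution on a finite type. -/
lemma sum_exp_le_of_abs_sub_le {V : Type*} [Fintype V] [Nonempty V] (c : ℝ) (hc1 : c ≤ 1)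
    (g : V → ℝ) (hg : ∀ v w, |g v - g w| ≤ c) :
    ∑ v, Real.exp (g v) ≤
      Fintype.card V * Real.exp ((∑ v, g v) / Fintype.card V + c ^ 2) := by
  have hn : (0 : ℝ) < Fintype.card V := by exact_mod_cast Fintype.card_pos
  set n : ℝ := (Fintype.card V : ℝ) with hndef
  set a : ℝ := (∑ v, g v) / n with ha
  have hsum : ∑ v, (g v - a) = 0 := by
    rw [Finset.sum_sub_distrib, Finset.sum_const, Finset.card_univ, nsmul_eq_mul, ← hndef, ha]
    field_simp
    ring
  have habs : ∀ v, |g v - a| ≤ c := by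
    intro v
    have h1 : g v - a = (∑ w, (g v - g w)) / n := by
      rw [Finset.sum_sub_distrib, Finset.sum_const, Finset.card_univ, nsmul_eq_mul, ← hndef, ha]
      field_simp
    rw [h1, abs_div, abs_of_pos hn, div_le_iff₀ hn]
    calc |∑ w, (g v - g w)| ≤ ∑ w, |g v - g w| := Finset.abs_sum_le_sum_abs _ _
      _ ≤ ∑ _w : V, c := Finset.sum_le_sum fun w _ => hg v w
      _ = c * n := by rw [Finset.sum_const, Finset.card_univ, nsmul_eq_mul, mul_comm]
  have hpt : ∀ v, Real.exp (g v) ≤ Real.exp a * (1 + (g v - a) + c ^ 2) := by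
    intro v
    have h2 : Real.exp (g v) = Real.exp a * Real.exp (g v - a) := by
      rw [← Real.exp_add]; ring_nf
    rw [h2]
    have h3 := Real.abs_exp_sub_one_sub_id_le (x := g v - a) ((habs v).trans hc1)
    have h4 : (g v - a) ^ 2 ≤ c ^ 2 := by
      rw [← sq_abs]; exact pow_le_pow_left₀ (abs_nonneg _) (habs v) 2
    have h5 := (abs_le.mp h3).2
    exact mul_le_mul_of_nonneg_left (by linarith) (Real.exp_pos a).le
  calc ∑ v, Real.exp (g v) ≤ ∑ v, Real.exp a * (1 + (g v - a) + c ^ 2) :=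
        Finset.sum_le_sum fun v _ => hpt v
    _ = Real.exp a * (n * (1 + c ^ 2)) := by
        rw [← Finset.mul_sum, Finset.sum_add_distrib, Finset.sum_add_distrib, hsum]
        simp only [Finset.sum_const, Finset.card_univ, nsmul_eq_mul, ← hndef]
        ring
    _ ≤ Real.exp a * (n * Real.exp (c ^ 2)) := by
        have := Real.add_one_le_exp (c ^ 2)
        gcongr
        linarith
    _ = n * Real.exp (a + c ^ 2) := by rw [Real.exp_add]; ring

/-- Exponential moment bound for functions with bounded differences on `V ^ N`. -/
lemma sum_exp_le_of_boundedDiff_fin {V : Type*} [Fintype V] [Nonempty V] (c : ℝ) (hc1 : c ≤ 1)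
    (N : ℕ) (f : (Fin N → V) → ℝ)
    (hf : ∀ x i v, |f (Function.update x i v) - f x| ≤ c) :
    ∑ x, Real.exp (f x) ≤ (Fintype.card V : ℝ) ^ N *
      Real.exp ((∑ x, f x) / (Fintype.card V : ℝ) ^ N + N * c ^ 2) := by
  have hn : (0 : ℝ) < Fintype.card V := by exact_mod_cast Fintype.card_pos
  induction N with
  | zero => simp
  | succ N ih =>
    have split : ∀ F : (Fin (N + 1) → V) → ℝ, ∑ x, F x = ∑ v, ∑ y, F (Fin.cons v y) := by
      intro F
      rw [← (Fin.consEquiv fun _ : Fin (N + 1) => V).sum_comp, Fintype.sum_prod_type]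
      rfl
    set n : ℝ := (Fintype.card V : ℝ) with hndef
    let g : V → ℝ := fun v => (∑ y : Fin N → V, f (Fin.cons v y)) / n ^ N
    have hg : ∀ v w, |g v - g w| ≤ c := by
      intro v w
      have hp : 0 < n ^ N := pow_pos hn N
      change |_ / _ - _ / _| ≤ c
      rw [← sub_div, ← Finset.sum_sub_distrib, abs_div, abs_of_pos hp, div_le_iff₀ hp]
      calc _ ≤ ∑ y : Fin N → V, |f (Fin.cons v y) - f (Fin.cons w y)| :=
            Finset.abs_sum_le_sum_abs _ _
        _ ≤ ∑ _y : Fin N → V, c := by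
            refine Finset.sum_le_sum fun y _ => ?_
            have := hf (Fin.cons w y) 0 v
            rwa [Fin.update_cons_zero] at this
        _ = c * n ^ N := by simp [hndef, mul_comm]
    have h1 : ∀ v, ∑ y : Fin N → V, Real.exp (f (Fin.cons v y)) ≤
        n ^ N * Real.exp (g v + N * c ^ 2) := by
      intro v
      refine ih (fun y => f (Fin.cons v y)) fun y i w => ?_
      have := hf (Fin.cons v y) i.succ w
      rwa [← Fin.cons_update] at this
    have hmean : (∑ x, f x) / n ^ (N + 1) = (∑ v, g v) / n := by
      rw [split, ← Finset.sum_div, pow_succ, div_div]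
    rw [split]
    calc _ ≤ ∑ v, n ^ N * Real.exp (g v + N * c ^ 2) := Finset.sum_le_sum fun v _ => h1 v
      _ = n ^ N * Real.exp (N * c ^ 2) * ∑ v, Real.exp (g v) := by
          rw [Finset.mul_sum]
          refine Finset.sum_congr rfl fun v _ => ?_
          rw [Real.exp_add]; ring
      _ ≤ n ^ N * Real.exp (N * c ^ 2) * (n * Real.exp ((∑ v, g v) / n + c ^ 2)) := by
          gcongr
          exact sum_exp_le_of_abs_sub_le c hc1 g hg
      _ = _ := by
          rw [hmean]
          push_cast
          rw [show (∑ v, g v) / n + ((N : ℝ) + 1) * c ^ 2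
            = N * c ^ 2 + ((∑ v, g v) / n + c ^ 2) by ring, Real.exp_add (N * c ^ 2)]
          ring

lemma sum_exp_le_of_boundedDiff {ι V : Type*} [Fintype ι] [DecidableEq ι] [Fintype V]
    [Nonempty V] (c : ℝ) (hc1 : c ≤ 1) (f : (ι → V) → ℝ)
    (hf : ∀ x i v, |f (Function.update x i v) - f x| ≤ c) :
    ∑ x, Real.exp (f x) ≤ (Fintype.card V : ℝ) ^ Fintype.card ι *
      Real.exp ((∑ x, f x) / (Fintype.card V : ℝ) ^ Fintype.card ι + Fintype.card ι * c ^ 2) := by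
  let e := Fintype.equivFin ι
  let E : (Fin (Fintype.card ι) → V) ≃ (ι → V) := e.symm.arrowCongr (Equiv.refl V)
  have := sum_exp_le_of_boundedDiff_fin c hc1 (Fintype.card ι) (fun x => f (E x)) (by
    intro x i v
    have hE : E (Function.update x i v) = Function.update (E x) (e.symm i) v := by
      funext j
      by_cases hj : e j = i
      · subst hj
        simp [E]
      · have hj' : j ≠ e.symm i := fun h => hj (by simp [h])
        simp [E, Function.update_of_ne hj, Function.update_of_ne hj']
    rw [hE]
    exact hf _ _ _)
  rwa [E.sum_comp fun x => Real.exp (f x), E.sum_comp f] at this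

/-- Lower tail bound for functions with bounded differences. -/
lemma card_lowerTail_le {ι V : Type*} [Fintype ι] [DecidableEq ι] [Fintype V]
    [Nonempty V] (c a b lam : ℝ) (hlam : 0 ≤ lam) (hc1 : lam * c ≤ 1) (f : (ι → V) → ℝ)
    (hf : ∀ x i v, |f (Function.update x i v) - f x| ≤ c)
    (ha : a * (Fintype.card V : ℝ) ^ Fintype.card ι ≤ ∑ x, f x) :
    ((univ.filter fun x => f x < b).card : ℝ) ≤ (Fintype.card V : ℝ) ^ Fintype.card ι *
      Real.exp (lam * (b - a) + Fintype.card ι * (lam * c) ^ 2) := by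
  have hn : (0 : ℝ) < (Fintype.card V : ℝ) ^ Fintype.card ι :=
    pow_pos (by exact_mod_cast Fintype.card_pos) _
  set n : ℝ := (Fintype.card V : ℝ) ^ Fintype.card ι with hndef
  have h1 := sum_exp_le_of_boundedDiff (lam * c) hc1 (fun x => -lam * f x) (by
    intro x i v
    rw [← mul_sub, abs_mul, abs_neg, abs_of_nonneg hlam]
    exact mul_le_mul_of_nonneg_left (hf x i v) hlam)
  rw [← Finset.mul_sum, ← hndef] at h1
  have h2 : ((univ.filter fun x => f x < b).card : ℝ) * Real.exp (-lam * b) ≤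
      ∑ x, Real.exp (-lam * f x) := by
    rw [← nsmul_eq_mul, ← Finset.sum_const]
    refine (Finset.sum_le_sum fun x hx => ?_).trans
      (Finset.sum_le_sum_of_subset_of_nonneg (Finset.filter_subset _ _)
        fun _ _ _ => (Real.exp_pos _).le)
    have hx' := (Finset.mem_filter.mp hx).2
    exact Real.exp_le_exp.mpr (by nlinarith)
  have h3 : -lam * (∑ x, f x) / n ≤ -lam * a := by
    rw [div_le_iff₀ hn]; nlinarith
  have h4 : ((univ.filter fun x => f x < b).card : ℝ) * Real.exp (-lam * b) ≤
      n * Real.exp (-lam * a + Fintype.card ι * (lam * c) ^ 2) :=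
    h2.trans (h1.trans (by gcongr))
  calc _ = ((univ.filter fun x => f x < b).card : ℝ) * Real.exp (-lam * b)
        * Real.exp (lam * b) := by
        rw [mul_assoc, ← Real.exp_add]; simp
    _ ≤ n * Real.exp (-lam * a + Fintype.card ι * (lam * c) ^ 2) * Real.exp (lam * b) := by
        gcongr
    _ = _ := by rw [mul_assoc, ← Real.exp_add]; ring_nf

/-- A uniformly random permutation sends a fixed embedding to a uniformly random embedding. -/
lemma card_perm_trans_mem {α ι : Type*} [Fintype α] [DecidableEq α] [Fintype ι]
    [DecidableEq ι] (A : Finset (ι ↪ α)) (a : ι ↪ α) :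
    Fintype.card (ι ↪ α) * (univ.filter fun σ : Equiv.Perm α => a.trans σ.toEmbedding ∈ A).card =
      Fintype.card (Equiv.Perm α) * A.card := by
  have hconst : ∀ b : ι ↪ α,
      (univ.filter fun σ : Equiv.Perm α => b.trans σ.toEmbedding ∈ A).card =
      (univ.filter fun σ : Equiv.Perm α => a.trans σ.toEmbedding ∈ A).card := by
    intro b
    obtain ⟨τ, hτ⟩ := Equiv.Perm.exists_extending_pair a b a.injective b.injective
    refine Finset.card_equiv (Equiv.mulRight τ) fun σ => ?_
    have : a.trans (σ * τ).toEmbedding = b.trans σ.toEmbedding := by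
      ext i; simp [hτ]
    simp [this]
  have hfib : ∀ σ : Equiv.Perm α,
      (univ.filter fun b : ι ↪ α => b.trans σ.toEmbedding ∈ A).card = A.card := by
    intro σ
    refine Finset.card_equiv (Equiv.embeddingCongr (Equiv.refl ι) σ) fun b => ?_
    have : Equiv.embeddingCongr (Equiv.refl ι) σ b = b.trans σ.toEmbedding := by
      ext i; simp
    simp [this]
  have h := Finset.sum_card_bipartiteAbove_eq_sum_card_bipartiteBelow
    (s := (univ : Finset (ι ↪ α))) (t := (univ : Finset (Equiv.Perm α)))
    (fun b σ => b.trans σ.toEmbedding ∈ A)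
  simp only [Finset.bipartiteAbove, Finset.bipartiteBelow] at h
  rw [Finset.sum_congr rfl fun b _ => hconst b, Finset.sum_congr rfl fun σ _ => hfib σ] at h
  simpa using h

/-- There are disjoint blocks of which at most the average proportion are in `A`. -/
lemma exists_disjoint_blocks {α : Type*} [Fintype α] [DecidableEq α] (m q : ℕ)
    (hq : q * m ≤ Fintype.card α) (A : Finset (Fin m ↪ α)) :
    ∃ x : Fin q → Fin m ↪ α, (Function.Injective fun p : Fin q × Fin m => x p.1 p.2) ∧
      Fintype.card (Fin m ↪ α) * (univ.filter fun j => x j ∈ A).card ≤ q * A.card := by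
  obtain ⟨E⟩ : Nonempty (Fin q × Fin m ↪ α) :=
    Function.Embedding.nonempty_of_card_le (by simpa using hq)
  let E' : Fin q → Fin m ↪ α := fun j =>
    ⟨fun i => E (j, i), fun i i' h => by simpa using E.injective h⟩
  obtain ⟨σ, -, hσ⟩ : ∃ σ ∈ (univ : Finset (Equiv.Perm α)),
      Fintype.card (Fin m ↪ α) *
        (univ.filter fun j => (E' j).trans σ.toEmbedding ∈ A).card ≤ q * A.card := by
    refine Finset.exists_le_of_sum_le Finset.univ_nonempty ?_
    rw [← Finset.mul_sum]
    have h := Finset.sum_card_bipartiteAbove_eq_sum_card_bipartiteBelow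
      (s := (univ : Finset (Equiv.Perm α))) (t := (univ : Finset (Fin q)))
      (fun σ j => (E' j).trans σ.toEmbedding ∈ A)
    simp only [Finset.bipartiteAbove, Finset.bipartiteBelow] at h
    rw [h, Finset.mul_sum, Finset.sum_congr rfl fun j _ => card_perm_trans_mem A (E' j)]
    simp only [Finset.sum_const, Finset.card_univ, Fintype.card_fin, smul_eq_mul]
    exact le_of_eq (by ring)
  refine ⟨fun j => (E' j).trans σ.toEmbedding, ?_, hσ⟩
  intro p p' h
  exact E.injective (σ.injective h)

/-- The pullback of the `k`-uniform hypergraph `H` along `x`. -/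
def hPull {m n : ℕ} (k : ℕ) (H : Finset (Finset (Fin n))) (x : Fin m → Fin n) :
    Finset (Finset (Fin m)) :=
  univ.filter fun e => e.card = k ∧ e.image x ∈ H

/-- Perfect matchings of disjoint blocks combine to a matching of `H`. -/
lemma exists_matching_of_blocks {m n q k : ℕ} (H : Finset (Finset (Fin n)))
    (x : Fin q → Fin m ↪ Fin n) (hx : Function.Injective fun p : Fin q × Fin m => x p.1 p.2)
    (J : Finset (Fin q)) (hJ : ∀ j ∈ J, ∃ M, HyperPM (hPull k H (x j)) M) :
    ∃ M : Finset (Finset (Fin n)), M ⊆ H ∧ (M : Set (Finset (Fin n))).PairwiseDisjoint id ∧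
      (M.biUnion id).card = J.card * m := by
  choose! M hM using hJ
  have himg : ∀ j ∈ J, (((M j).image fun e => e.image (x j)).biUnion id) = univ.map (x j) := by
    intro j hj
    rw [← (hM j hj).2.2]
    ext v
    simp only [mem_biUnion, mem_image, id, mem_map]
    constructor
    · rintro ⟨_, ⟨e, he, rfl⟩, hv⟩
      obtain ⟨i, hi, rfl⟩ := mem_image.mp hv
      exact ⟨i, ⟨e, he, hi⟩, rfl⟩
    · rintro ⟨i, ⟨e, he, hi⟩, rfl⟩
      exact ⟨_, ⟨e, he, rfl⟩, mem_image_of_mem _ hi⟩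
  refine ⟨J.biUnion fun j => (M j).image fun e => e.image (x j), ?_, ?_, ?_⟩
  · intro h hh
    simp only [mem_biUnion, mem_image] at hh
    obtain ⟨j, hj, e, he, rfl⟩ := hh
    have := (hM j hj).1 he
    exact (mem_filter.mp this).2.2
  · intro h hh h' hh' hne
    simp only [coe_biUnion, coe_image, Set.mem_iUnion, Set.mem_image, mem_coe] at hh hh'
    obtain ⟨j, hj, e, he, rfl⟩ := hh
    obtain ⟨j', hj', e', he', rfl⟩ := hh'
    change Disjoint (e.image (x j)) (e'.image (x j'))
    rw [Finset.disjoint_left]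
    intro v hv hv'
    obtain ⟨i, hi, rfl⟩ := mem_image.mp hv
    obtain ⟨i', hi', h⟩ := mem_image.mp hv'
    have h2 := @hx (j', i') (j, i) h
    obtain ⟨rfl, rfl⟩ := Prod.mk.inj h2
    have hee : e ≠ e' := fun h => hne (by rw [h])
    exact Finset.disjoint_left.mp ((hM j' hj).2.1 he he' hee) hi hi'
  · rw [Finset.biUnion_biUnion, Finset.biUnion_congr rfl himg, Finset.card_biUnion]
    · simp
    · intro j _ j' _ hne
      change Disjoint (univ.map (x j)) (univ.map (x j'))
      rw [Finset.disjoint_left]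
      intro v hv hv'
      obtain ⟨i, -, rfl⟩ := mem_map.mp hv
      obtain ⟨i', -, h⟩ := mem_map.mp hv'
      exact hne (Prod.mk.inj (@hx (j', i') (j, i) h)).1.symm

lemma diracT_nonempty {n k l : ℕ} (hl : l ≤ n) :
    (n.choose (k - l) + 1) ∈ {d : ℕ | ∀ H : Finset (Finset (Fin n)), (∀ e ∈ H, e.card = k) →
      (∀ S : Finset (Fin n), S.card = l → d ≤ hDeg H S) → ∃ M, HyperPM H M} := by
  intro H hH hd
  obtain ⟨S, -, hS⟩ := Finset.exists_subset_card_eq (s := (univ : Finset (Fin n))) (n := l)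
    (by simpa using hl)
  exfalso
  have h1 := hd S hS
  have h2 : hDeg H S ≤ ((univ : Finset (Fin n)).powersetCard (k - l)).card := by
    refine Finset.card_le_card_of_injOn (fun h => h \ S) ?_ ?_
    · intro h hh
      obtain ⟨hh, hSh⟩ := mem_filter.mp hh
      simp only [mem_coe, mem_powersetCard, subset_univ, true_and]
      rw [Finset.card_sdiff_of_subset hSh, hH h hh, hS]
    · intro h hh h' hh' heq
      have hSh := (mem_filter.mp hh).2
      have hSh' := (mem_filter.mp hh').2
      rw [← Finset.sdiff_union_of_subset hSh, ← Finset.sdiff_union_of_subset hSh']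
      exact congrArg (· ∪ S) heq
  rw [Finset.card_powersetCard, Finset.card_univ, Fintype.card_fin] at h2
  omega

lemma exists_hyperPM_of_diracT_le {n k l : ℕ} (hl : l ≤ n) (H : Finset (Finset (Fin n)))
    (hH : ∀ e ∈ H, e.card = k) (hd : ∀ S : Finset (Fin n), S.card = l → diracT n k l ≤ hDeg H S) :
    ∃ M, HyperPM H M :=
  Nat.sInf_mem ⟨_, diracT_nonempty hl⟩ H hH hd

/-- Eventually the Dirac numbers are below the threshold plus a constant. -/
lemma eventually_diracT_lt (k l : ℕ) (η : ℝ) (hη : 0 < η) :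
    ∃ m₀ : ℕ, ∀ m : ℕ, m₀ ≤ m → k ∣ m →
      (diracT m k l : ℝ) < (diracThreshold k l + η) * (m.choose (k - l)) := by
  have hb : Filter.IsBoundedUnder (· ≤ ·) (Filter.atTop ⊓ Filter.principal {n | k ∣ n})
      (fun n : ℕ => (diracT n k l : ℝ) / (n.choose (k - l))) := by
    refine Filter.isBoundedUnder_of_eventually_le (a := 2) ?_
    refine Filter.Eventually.filter_mono inf_le_left ?_
    filter_upwards [Filter.eventually_ge_atTop (l + k)] with n hn
    have hpos : 0 < n.choose (k - l) := Nat.choose_pos (by omega)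
    rw [div_le_iff₀ (by exact_mod_cast hpos)]
    have : diracT n k l ≤ n.choose (k - l) + 1 := Nat.sInf_le (diracT_nonempty (by omega))
    have : diracT n k l ≤ 2 * n.choose (k - l) := by omega
    exact_mod_cast this
  have h := Filter.eventually_lt_of_limsup_lt
    (show diracThreshold k l < diracThreshold k l + η by linarith) hb
  rw [Filter.eventually_inf_principal] at h
  obtain ⟨m₀, hm₀⟩ := Filter.eventually_atTop.mp h
  refine ⟨max m₀ k, fun m hm hk => ?_⟩
  have h1 := hm₀ m ((le_max_left _ _).trans hm) hk
  have hpos : 0 < m.choose (k - l) :=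
    Nat.choose_pos ((Nat.sub_le _ _).trans ((le_max_right _ _).trans hm))
  rwa [div_lt_iff₀ (by exact_mod_cast hpos)] at h1

/-- The number of `r`-sets of indices whose image under `z` completes `S` to an edge of `H`. -/
def linkCount {ι : Type*} [Fintype ι] {n : ℕ} (H : Finset (Finset (Fin n))) (S : Finset (Fin n))
    (r : ℕ) (z : ι → Fin n) : ℕ :=
  ((univ.powersetCard r).filter fun R : Finset ι => S ∪ R.image z ∈ H).card

lemma factorial_mul_pow_le_card_image_eq {ι V : Type*} [Fintype ι] [DecidableEq ι] [Fintype V]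
    [DecidableEq V] (R : Finset ι) (g : Finset V) (h : R.card = g.card) :
    R.card.factorial * Fintype.card V ^ (Fintype.card ι - R.card) ≤
      (univ.filter fun z : ι → V => R.image z = g).card := by
  have e0 : R ≃ g := Finset.equivOfCardEq h
  have hc : Fintype.card ((R ≃ g) × ({i // i ∉ R} → V)) =
      R.card.factorial * Fintype.card V ^ (Fintype.card ι - R.card) := by
    rw [Fintype.card_prod, Fintype.card_equiv e0, Fintype.card_fun, Fintype.card_coe,
      Fintype.card_subtype_compl, Fintype.card_coe]
  rw [← hc, ← Finset.card_univ]
  refine Finset.card_le_card_of_injOn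
    (fun p i => if hi : i ∈ R then (p.1 ⟨i, hi⟩ : V) else p.2 ⟨i, hi⟩) ?_ ?_
  · rintro ⟨e, w⟩ -
    simp only [coe_filter, mem_univ, true_and, Set.mem_ofPred_eq]
    ext v
    simp only [mem_image]
    constructor
    · rintro ⟨i, hi, rfl⟩
      simp [hi]
    · intro hv
      refine ⟨e.symm ⟨v, hv⟩, (e.symm ⟨v, hv⟩).2, ?_⟩
      simp
  · rintro ⟨e, w⟩ - ⟨e', w'⟩ - heq
    have h1 : e = e' := by
      ext ⟨i, hi⟩
      have := congrFun heq i
      simpa [hi] using this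
    have h2 : w = w' := by
      ext ⟨i, hi⟩
      have := congrFun heq i
      simpa [hi] using this
    rw [h1, h2]

lemma le_sum_linkCount {ι : Type*} [Fintype ι] [DecidableEq ι] {n l r : ℕ}
    (H : Finset (Finset (Fin n))) (hH : ∀ e ∈ H, e.card = l + r) (S : Finset (Fin n))
    (hS : S.card = l) :
    (Fintype.card ι).choose r * (hDeg H S * (r.factorial * n ^ (Fintype.card ι - r))) ≤
      ∑ z : ι → Fin n, linkCount H S r z := by
  have hswap := Finset.sum_card_bipartiteAbove_eq_sum_card_bipartiteBelow
    (s := (univ : Finset (ι → Fin n))) (t := (univ : Finset ι).powersetCard r)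
    (fun z R => S ∪ R.image z ∈ H)
  simp only [Finset.bipartiteAbove, Finset.bipartiteBelow] at hswap
  unfold linkCount
  rw [hswap, ← Finset.card_univ (α := ι), ← Finset.card_powersetCard, ← smul_eq_mul]
  refine Finset.card_nsmul_le_sum _ _ _ fun R hR => ?_
  have hR' : R.card = r := (mem_powersetCard.mp hR).2
  calc hDeg H S * (r.factorial * n ^ ((univ : Finset ι).card - r))
      ≤ ∑ h ∈ H.filter (fun h => S ⊆ h),
          (univ.filter fun z : ι → Fin n => R.image z = h \ S).card := by
        unfold hDeg
        rw [← smul_eq_mul]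
        refine Finset.card_nsmul_le_sum _ _ _ fun h hh => ?_
        obtain ⟨hh, hSh⟩ := mem_filter.mp hh
        have := factorial_mul_pow_le_card_image_eq (ι := ι) R (h \ S) (by
          rw [Finset.card_sdiff_of_subset hSh, hH h hh, hS, hR']; omega)
        simpa [hR'] using this
    _ = ((H.filter (fun h => S ⊆ h)).biUnion fun h =>
          univ.filter fun z : ι → Fin n => R.image z = h \ S).card := by
        rw [Finset.card_biUnion]
        intro h hh h' hh' hne
        change Disjoint (univ.filter _) (univ.filter _)
        rw [Finset.disjoint_left]
        intro z hz hz'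
        have h1 := (mem_filter.mp hz).2
        have h2 := (mem_filter.mp hz').2
        apply hne
        rw [← Finset.sdiff_union_of_subset (mem_filter.mp hh).2,
          ← Finset.sdiff_union_of_subset (mem_filter.mp hh').2, ← h1, ← h2]
    _ ≤ _ := by
        refine Finset.card_le_card fun z hz => ?_
        simp only [mem_biUnion, mem_filter, mem_univ, true_and] at hz ⊢
        obtain ⟨h, ⟨hh, hSh⟩, hz⟩ := hz
        rwa [hz, Finset.union_sdiff_of_subset hSh]

lemma card_powersetCard_filter_mem_le {ι : Type*} [Fintype ι] [DecidableEq ι] (r : ℕ) (i : ι) :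
    (((univ : Finset ι).powersetCard r).filter fun R => i ∈ R).card ≤
      (Fintype.card ι - 1).choose (r - 1) := by
  have : (Fintype.card ι - 1).choose (r - 1) =
      (((univ : Finset ι).erase i).powersetCard (r - 1)).card := by
    rw [Finset.card_powersetCard, Finset.card_erase_of_mem (mem_univ _), Finset.card_univ]
  rw [this]
  refine Finset.card_le_card_of_injOn (fun R => R.erase i) ?_ ?_
  · intro R hR
    obtain ⟨hR, hi⟩ := mem_filter.mp hR
    refine mem_coe.mpr (mem_powersetCard.mpr ⟨Finset.erase_subset_erase _ (subset_univ _), ?_⟩)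
    rw [Finset.card_erase_of_mem hi, (mem_powersetCard.mp hR).2]
  · intro R hR R' hR' h
    rw [← Finset.insert_erase (mem_filter.mp hR).2, ← Finset.insert_erase (mem_filter.mp hR').2]
    exact congrArg (insert i) h

lemma linkCount_le_of_eqOn {ι : Type*} [Fintype ι] [DecidableEq ι] {n : ℕ}
    (H : Finset (Finset (Fin n))) (S : Finset (Fin n)) (r : ℕ) (z z' : ι → Fin n) (i : ι)
    (h : ∀ j, j ≠ i → z j = z' j) :
    linkCount H S r z ≤ linkCount H S r z' + (Fintype.card ι - 1).choose (r - 1) := by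
  refine le_trans (Finset.card_le_card ?_) ((Finset.card_union_le _ _).trans
    (Nat.add_le_add_left (card_powersetCard_filter_mem_le r i) _))
  intro R hR
  obtain ⟨hR, hz⟩ := mem_filter.mp hR
  by_cases hi : i ∈ R
  · exact mem_union_right _ (mem_filter.mpr ⟨hR, hi⟩)
  · refine mem_union_left _ (mem_filter.mpr ⟨hR, ?_⟩)
    rwa [← Finset.image_congr (f := z) fun j hj => h j (by rintro rfl; exact hi hj)]

lemma abs_linkCount_update_sub_le {ι : Type*} [Fintype ι] [DecidableEq ι] {n : ℕ}
    (H : Finset (Finset (Fin n))) (S : Finset (Fin n)) (r : ℕ) (z : ι → Fin n) (i : ι)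
    (v : Fin n) :
    |(linkCount H S r (Function.update z i v) : ℝ) - linkCount H S r z| ≤
      ((Fintype.card ι - 1).choose (r - 1) : ℕ) := by
  have h : ∀ j, j ≠ i → Function.update z i v j = z j := fun j hj => Function.update_of_ne hj _ _
  have h1 := linkCount_le_of_eqOn H S r _ z i h
  have h2 := linkCount_le_of_eqOn H S r z _ i fun j hj => (h j hj).symm
  have h1' : (linkCount H S r (Function.update z i v) : ℝ) ≤ linkCount H S r z +
    ((Fintype.card ι - 1).choose (r - 1) : ℕ) := by exact_mod_cast h1
  have h2' : (linkCount H S r z : ℝ) ≤ linkCount H S r (Function.update z i v) +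
    ((Fintype.card ι - 1).choose (r - 1) : ℕ) := by exact_mod_cast h2
  rw [abs_le]
  constructor <;> linarith

lemma linkCount_le_hDeg_hPull {m n l r : ℕ} (H : Finset (Finset (Fin n))) (x : Fin m → Fin n)
    (T : Finset (Fin m)) (hT : T.card = l) :
    linkCount H (T.image x) r (fun i : {i // i ∉ T} => x i) ≤ hDeg (hPull (l + r) H x) T := by
  have hdisj : ∀ R : Finset {i // i ∉ T}, Disjoint T (R.map (Function.Embedding.subtype _)) := by
    intro R
    rw [Finset.disjoint_left]
    intro i hi hi'
    obtain ⟨j, -, rfl⟩ := mem_map.mp hi'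
    exact j.2 hi
  refine Finset.card_le_card_of_injOn
    (fun R => T ∪ R.map (Function.Embedding.subtype _)) ?_ ?_
  · intro R hR
    obtain ⟨hR, hH⟩ := mem_filter.mp hR
    refine mem_coe.mpr (mem_filter.mpr ⟨mem_filter.mpr ⟨mem_univ _, ?_, ?_⟩,
      subset_union_left⟩)
    · rw [Finset.card_union_of_disjoint (hdisj R), hT, card_map, (mem_powersetCard.mp hR).2]
    · rw [Finset.image_union, Finset.map_eq_image, Finset.image_image]
      exact hH
  · intro R _ R' _ h
    have h' := congrArg (· \ T) h
    simp only [Finset.union_sdiff_cancel_left (hdisj _)] at h'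
    exact Finset.map_injective _ h'

lemma card_image_mem_le {m n l : ℕ} (T : Finset (Fin m)) (hT : T.card = l)
    (B : Finset (Finset (Fin n))) (hB : ∀ S ∈ B, S.card = l) :
    (univ.filter fun x : Fin m → Fin n => T.image x ∈ B).card ≤
      B.card * (l ^ l * n ^ (m - l)) := by
  calc _ ≤ (B.biUnion fun S => Fintype.piFinset fun i => if i ∈ T then S else univ).card := by
        refine Finset.card_le_card fun x hx => ?_
        refine mem_biUnion.mpr ⟨_, (mem_filter.mp hx).2, Fintype.mem_piFinset.mpr fun i => ?_⟩
        split_ifs with hi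
        · exact mem_image_of_mem _ hi
        · exact mem_univ _
    _ ≤ ∑ S ∈ B, _ := Finset.card_biUnion_le
    _ ≤ B.card * (l ^ l * n ^ (m - l)) := by
        rw [← smul_eq_mul]
        refine Finset.sum_le_card_nsmul _ _ _ fun S hS => le_of_eq ?_
        rw [Fintype.card_piFinset]
        simp only [apply_ite Finset.card, hB S hS, Finset.card_univ, Fintype.card_fin]
        rw [Finset.prod_ite]
        simp [Finset.filter_not, hT, Finset.card_sdiff_of_subset]

/-- A bound for each restriction to `T` yields a bound for all functions. -/
lemma card_filter_restrict_le {m n : ℕ} (T : Finset (Fin m))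
    (P : ({i // i ∈ T} → Fin n) → ({i // i ∉ T} → Fin n) → Prop)
    [∀ y z, Decidable (P y z)] (C : ℝ)
    (hP : ∀ y, ((univ.filter fun z => P y z).card : ℝ) ≤ C) :
    ((univ.filter fun x : Fin m → Fin n => P (fun i => x i) (fun i => x i)).card : ℝ) ≤
      (n : ℝ) ^ T.card * C := by
  have h : (univ.filter fun x : Fin m → Fin n => P (fun i => x i) (fun i => x i)).card =
      ∑ y, (univ.filter fun z => P y z).card := by
    rw [← Finset.card_sigma]
    refine Finset.card_equiv ((Equiv.piEquivPiSubtypeProd (fun i => i ∈ T) fun _ => Fin n).trans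
      (Equiv.sigmaEquivProd _ _).symm) fun x => ?_
    simp [Equiv.piEquivPiSubtypeProd]
  rw [h]
  push_cast
  calc _ ≤ ∑ _y : {i // i ∈ T} → Fin n, C := Finset.sum_le_sum fun y _ => hP y
    _ = _ := by simp

/-- Few functions map `T` onto a set of large degree in `H` while `T` has small degree in the
pullback of `H`. -/
lemma card_low_hDeg_hPull_le {m n l r : ℕ} (hn : 0 < n) (hr : l + r ≤ m)
    (H : Finset (Finset (Fin n))) (hH : ∀ e ∈ H, e.card = l + r)
    (T : Finset (Fin m)) (hT : T.card = l) (A a b lam : ℝ) (hlam : 0 ≤ lam)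
    (hlam1 : lam * ((m - 1).choose (r - 1) : ℕ) ≤ 1)
    (ha : a ≤ ((m - l).choose r : ℕ) * (A * r.factorial / (n : ℝ) ^ r)) :
    ((univ.filter fun x : Fin m → Fin n => ((T.image x).card = l ∧ A ≤ hDeg H (T.image x)) ∧
      (hDeg (hPull (l + r) H x) T : ℝ) < b).card : ℝ) ≤
      (n : ℝ) ^ m * Real.exp (lam * (b - a) + m * (lam * ((m - 1).choose (r - 1) : ℕ)) ^ 2) := by
  classical
  have : Nonempty (Fin n) := ⟨⟨0, hn⟩⟩
  have hn' : (0 : ℝ) < n := by exact_mod_cast hn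
  have hcard : Fintype.card {i // i ∉ T} = m - l := by
    rw [Fintype.card_subtype_compl, Fintype.card_coe, Fintype.card_fin, hT]
  set c : ℝ := (((m - 1).choose (r - 1) : ℕ) : ℝ) with hc
  set E : ℝ := Real.exp (lam * (b - a) + m * (lam * c) ^ 2) with hE
  let P : ({i // i ∈ T} → Fin n) → ({i // i ∉ T} → Fin n) → Prop := fun y z =>
    ((univ.image y).card = l ∧ A ≤ hDeg H (univ.image y)) ∧
      (linkCount H (univ.image y) r z : ℝ) < b
  have himg : ∀ x : Fin m → Fin n, univ.image (fun i : {i // i ∈ T} => x i) = T.image x := by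
    intro x
    ext v
    simp
  have hP : ∀ y, ((univ.filter fun z => P y z).card : ℝ) ≤ (n : ℝ) ^ (m - l) * E := by
    intro y
    by_cases hy : (univ.image y).card = l ∧ A ≤ hDeg H (univ.image y)
    · have hmean : a * (Fintype.card (Fin n) : ℝ) ^ Fintype.card {i // i ∉ T} ≤
          ∑ z : {i // i ∉ T} → Fin n, (linkCount H (univ.image y) r z : ℝ) := by
        have h := le_sum_linkCount (ι := {i // i ∉ T}) H hH (univ.image y) hy.1
        rw [hcard] at h
        have h' : ((m - l).choose r : ℝ) * ((hDeg H (univ.image y) : ℝ) *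
            (r.factorial * (n : ℝ) ^ (m - l - r))) ≤
          ∑ z : {i // i ∉ T} → Fin n, (linkCount H (univ.image y) r z : ℝ) := by
          exact_mod_cast h
        refine le_trans ?_ h'
        rw [hcard, Fintype.card_fin]
        calc a * (n : ℝ) ^ (m - l)
            ≤ ((m - l).choose r : ℕ) * (A * r.factorial / (n : ℝ) ^ r) * (n : ℝ) ^ (m - l) := by
              gcongr
          _ = ((m - l).choose r : ℕ) * (A * (r.factorial * (n : ℝ) ^ (m - l - r))) := by
              have : (n : ℝ) ^ (m - l) = (n : ℝ) ^ r * (n : ℝ) ^ (m - l - r) := by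
                rw [← pow_add]; congr 1; omega
              rw [this]
              field_simp
          _ ≤ _ := by
              gcongr
              exact hy.2
      have hmono : ((m - l - 1).choose (r - 1) : ℝ) ≤ c := by
        rw [hc]
        exact_mod_cast Nat.choose_le_choose _ (by omega)
      have htail := card_lowerTail_le c a b lam hlam hlam1
        (fun z : {i // i ∉ T} → Fin n => (linkCount H (univ.image y) r z : ℝ))
        (fun z i v => (abs_linkCount_update_sub_le H _ r z i v).trans (by rwa [hcard])) hmean
      rw [hcard, Fintype.card_fin] at htail
      refine le_trans (Nat.cast_le.mpr (Finset.card_le_card ?_)) (htail.trans ?_)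
      · intro z hz
        exact mem_filter.mpr ⟨mem_univ _, (mem_filter.mp hz).2.2⟩
      · have hml : ((m - l : ℕ) : ℝ) ≤ m := by exact_mod_cast Nat.sub_le _ _
        rw [hE]
        gcongr
    · have : (univ.filter fun z => P y z) = ∅ :=
        Finset.filter_eq_empty_iff.mpr fun z _ h => hy h.1
      rw [this, hE]
      simp only [card_empty, Nat.cast_zero]
      positivity
  have h := card_filter_restrict_le T P _ hP
  have hpow : (n : ℝ) ^ T.card * ((n : ℝ) ^ (m - l) * E) = (n : ℝ) ^ m * E := by
    rw [← mul_assoc, ← pow_add, hT]; congr 2; omega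
  rw [hpow] at h
  refine le_trans (Nat.cast_le.mpr (Finset.card_le_card ?_)) h
  intro x hx
  obtain ⟨-, hx1, hx2⟩ := mem_filter.mp hx
  refine mem_filter.mpr ⟨mem_univ _, ?_, ?_⟩
  · rw [himg]; exact hx1
  · rw [himg]
    exact lt_of_le_of_lt (by exact_mod_cast linkCount_le_hDeg_hPull H x T hT) hx2

/-- Few embeddings pull `H` back to a hypergraph of small minimum `l`-degree. -/
lemma card_bad_embeddings_le {m n l r : ℕ} (hn : 0 < n) (hr : l + r ≤ m)
    (H : Finset (Finset (Fin n))) (hH : ∀ e ∈ H, e.card = l + r)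
    (A a b lam δ E : ℝ) (hlam : 0 ≤ lam) (hδ : 0 ≤ δ)
    (hlam1 : lam * ((m - 1).choose (r - 1) : ℕ) ≤ 1)
    (ha : a ≤ ((m - l).choose r : ℕ) * (A * r.factorial / (n : ℝ) ^ r))
    (hE : Real.exp (lam * (b - a) + m * (lam * ((m - 1).choose (r - 1) : ℕ)) ^ 2) ≤ E)
    (hB : (((univ.powersetCard l).filter fun S : Finset (Fin n) =>
      (hDeg H S : ℝ) < A).card : ℝ) ≤ δ * (n.choose l : ℝ)) :
    ((univ.filter fun x : Fin m ↪ Fin n => ∃ T : Finset (Fin m), T.card = l ∧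
      (hDeg (hPull (l + r) H x) T : ℝ) < b).card : ℝ) ≤
      (m : ℝ) ^ l * (δ * (l : ℝ) ^ l + E) * (n : ℝ) ^ m := by
  classical
  set B := (univ.powersetCard l).filter fun S : Finset (Fin n) => (hDeg H S : ℝ) < A with hBdef
  let F : Finset (Fin m) → Finset (Fin m → Fin n) := fun T =>
    (univ.filter fun x : Fin m → Fin n => T.image x ∈ B) ∪
    (univ.filter fun x : Fin m → Fin n => ((T.image x).card = l ∧ A ≤ hDeg H (T.image x)) ∧
      (hDeg (hPull (l + r) H x) T : ℝ) < b)
  have hsub : (univ.filter fun x : Fin m ↪ Fin n => ∃ T : Finset (Fin m), T.card = l ∧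
      (hDeg (hPull (l + r) H x) T : ℝ) < b).card ≤
      (((univ : Finset (Fin m)).powersetCard l).biUnion F).card := by
    refine Finset.card_le_card_of_injOn (fun x => (x : Fin m → Fin n)) ?_
      (fun x _ y _ h => DFunLike.coe_injective h)
    intro x hx
    obtain ⟨T, hT, hx⟩ := (mem_filter.mp hx).2
    refine mem_coe.mpr (mem_biUnion.mpr ⟨T, mem_powersetCard.mpr ⟨subset_univ _, hT⟩, ?_⟩)
    have hcard : (T.image x).card = l := by rw [Finset.card_image_of_injective _ x.injective, hT]
    by_cases hA : (hDeg H (T.image x) : ℝ) < A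
    · exact mem_union_left _ (mem_filter.mpr ⟨mem_univ _, mem_filter.mpr
        ⟨mem_powersetCard.mpr ⟨subset_univ _, hcard⟩, hA⟩⟩)
    · exact mem_union_right _ (mem_filter.mpr ⟨mem_univ _, ⟨hcard, not_lt.mp hA⟩, hx⟩)
  have hF : ∀ T ∈ (univ : Finset (Fin m)).powersetCard l,
      ((F T).card : ℝ) ≤ (δ * (l : ℝ) ^ l + E) * (n : ℝ) ^ m := by
    intro T hT
    have hT := (mem_powersetCard.mp hT).2
    have h1 : ((univ.filter fun x : Fin m → Fin n => T.image x ∈ B).card : ℝ) ≤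
        δ * (l : ℝ) ^ l * (n : ℝ) ^ m := by
      have h := card_image_mem_le T hT B fun S hS =>
        (mem_powersetCard.mp (mem_filter.mp hS).1).2
      have h' : ((univ.filter fun x : Fin m → Fin n => T.image x ∈ B).card : ℝ) ≤
        (B.card : ℝ) * ((l : ℝ) ^ l * (n : ℝ) ^ (m - l)) := by exact_mod_cast h
      have hch : (n.choose l : ℝ) ≤ (n : ℝ) ^ l := by exact_mod_cast Nat.choose_le_pow n l
      calc _ ≤ _ := h'
        _ ≤ δ * (n : ℝ) ^ l * ((l : ℝ) ^ l * (n : ℝ) ^ (m - l)) := by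
            gcongr
            exact hB.trans (by gcongr)
        _ = _ := by
            have : (n : ℝ) ^ m = (n : ℝ) ^ l * (n : ℝ) ^ (m - l) := by
              rw [← pow_add]; congr 1; omega
            rw [this]; ring
    have h2 := (card_low_hDeg_hPull_le hn hr H hH T hT A a b lam hlam hlam1 ha).trans
      (mul_le_mul_of_nonneg_left hE (by positivity))
    have h3 : ((F T).card : ℝ) ≤ _ := Nat.cast_le.mpr (Finset.card_union_le _ _)
    rw [Nat.cast_add] at h3
    linarith
  have hE0 : 0 ≤ E := (Real.exp_pos _).le.trans hE
  calc _ ≤ ((((univ : Finset (Fin m)).powersetCard l).biUnion F).card : ℝ) := by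
        exact_mod_cast hsub
    _ ≤ ∑ T ∈ (univ : Finset (Fin m)).powersetCard l, ((F T).card : ℝ) := by
        exact_mod_cast Finset.card_biUnion_le
    _ ≤ (m.choose l : ℝ) * ((δ * (l : ℝ) ^ l + E) * (n : ℝ) ^ m) := by
        have := Finset.sum_le_card_nsmul _ _ _ hF
        rwa [nsmul_eq_mul, Finset.card_powersetCard, Finset.card_univ, Fintype.card_fin] at this
    _ ≤ (m : ℝ) ^ l * ((δ * (l : ℝ) ^ l + E) * (n : ℝ) ^ m) := by
        gcongr
        exact_mod_cast Nat.choose_le_pow m l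
    _ = _ := by ring

lemma tendsto_descFactorial_div_pow (r : ℕ) :
    Filter.Tendsto (fun n : ℕ => (n.descFactorial r : ℝ) / (n : ℝ) ^ r) Filter.atTop (nhds 1) := by
  refine (Asymptotics.isEquivalent_iff_tendsto_one ?_).mp (isEquivalent_descFactorial r)
  filter_upwards [Filter.eventually_gt_atTop 0] with n hn
  have : (0 : ℝ) < n := by exact_mod_cast hn
  positivity

lemma tendsto_choose_sub_div_choose (l r : ℕ) :
    Filter.Tendsto (fun m : ℕ => ((m - l).choose r : ℝ) / (m.choose r : ℝ))
      Filter.atTop (nhds 1) := by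
  rw [← Filter.tendsto_add_atTop_iff_nat l]
  have h1 := tendsto_descFactorial_div_pow r
  have h2 := (Filter.tendsto_add_atTop_iff_nat l).mpr h1
  have h3 := (tendsto_natCast_div_add_atTop (𝕜 := ℝ) (l : ℝ)).pow r
  have h := (h1.mul h3).div h2 one_ne_zero
  simp only [one_pow, mul_one, div_one] at h
  refine h.congr' ?_
  filter_upwards [Filter.eventually_gt_atTop r] with n hn
  have hn0 : (0 : ℝ) < n := by exact_mod_cast (by omega : 0 < n)
  have hd : (0 : ℝ) < (n + l).choose r := by exact_mod_cast Nat.choose_pos (by omega)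
  simp only [Pi.div_apply, Nat.add_sub_cancel, Nat.descFactorial_eq_factorial_mul_choose]
  have hf : (0 : ℝ) < r.factorial := by exact_mod_cast Nat.factorial_pos r
  push_cast
  rw [div_pow]
  field_simp

/-- A block size for which all error terms are small. -/
lemma exists_block_size (k l : ℕ) (hlk : l < k) (γ ε a κ : ℝ) (hγ : 0 < γ) (hε : 0 < ε)
    (hκ : 0 < κ) :
    ∃ m : ℕ, k ∣ m ∧ k ≤ m ∧
      (diracT m k l : ℝ) < (diracThreshold k l + ε / 4) * (m.choose (k - l)) ∧
      (a - ε / 8) * (m.choose (k - l)) ≤ (a - ε / 16) * ((m - l).choose (k - l) : ℕ) ∧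
      (m : ℝ) ^ l * Real.exp (-κ * m) ≤ γ / 8 := by
  obtain ⟨m₁, hm₁⟩ := eventually_diracT_lt k l (ε / 4) (by linarith)
  have h2 : ∀ᶠ m : ℕ in Filter.atTop,
      (a - ε / 8) * (m.choose (k - l)) ≤ (a - ε / 16) * ((m - l).choose (k - l) : ℕ) := by
    have h := (tendsto_choose_sub_div_choose l (k - l)).const_mul (a - ε / 16)
    rw [mul_one] at h
    filter_upwards [h.eventually (eventually_gt_nhds (show a - ε / 8 < a - ε / 16 by linarith)),
      Filter.eventually_ge_atTop k] with m hm hmk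
    have hpos : (0 : ℝ) < m.choose (k - l) := by
      exact_mod_cast Nat.choose_pos ((Nat.sub_le _ _).trans hmk)
    rw [← mul_div_assoc, lt_div_iff₀ hpos] at hm
    exact hm.le
  have h3 : ∀ᶠ m : ℕ in Filter.atTop, (m : ℝ) ^ l * Real.exp (-κ * m) ≤ γ / 8 := by
    have h := (Real.tendsto_pow_mul_exp_neg_atTop_nhds_zero l).comp
      (tendsto_natCast_atTop_atTop.const_mul_atTop hκ)
    have hκl : 0 < κ ^ l := pow_pos hκ l
    filter_upwards [h.eventually (eventually_lt_nhds (show 0 < κ ^ l * (γ / 8) by positivity))]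
      with m hm
    simp only [Function.comp_apply, mul_pow, mul_assoc] at hm
    rw [neg_mul]
    exact (lt_of_mul_lt_mul_left hm hκl.le).le
  obtain ⟨m₂, hm₂⟩ := Filter.eventually_atTop.mp (h2.and h3)
  have hle : max m₁ (max m₂ 1) ≤ k * max m₁ (max m₂ 1) := Nat.le_mul_of_pos_left _ (by omega)
  have hle' : k ≤ k * max m₁ (max m₂ 1) := Nat.le_mul_of_pos_right _ (by omega)
  obtain ⟨h4, h5⟩ := hm₂ (k * max m₁ (max m₂ 1)) (by omega)
  exact ⟨k * max m₁ (max m₂ 1), dvd_mul_right _ _, hle',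
    hm₁ _ (by omega) (dvd_mul_right _ _), h4, h5⟩

/-- If a small proportion of the embeddings of `Fin m` is bad, then `H` has a large matching. -/
lemma exists_large_matching {n m k l : ℕ} (hl : l ≤ m) (hm : 0 < m) (γ : ℝ) (hγ : 0 < γ)
    (hγ1 : γ ≤ 1) (hmn : 2 * m / γ ≤ n) (H : Finset (Finset (Fin n))) (b : ℝ)
    (hb : (diracT m k l : ℝ) < b) (hdesc : (n : ℝ) ^ m ≤ 2 * n.descFactorial m)
    (hbad : ((univ.filter fun x : Fin m ↪ Fin n => ∃ T : Finset (Fin m), T.card = l ∧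
      (hDeg (hPull k H x) T : ℝ) < b).card : ℝ) ≤ γ / 4 * (n : ℝ) ^ m) :
    ∃ M : Finset (Finset (Fin n)), M ⊆ H ∧ (M : Set (Finset (Fin n))).PairwiseDisjoint id ∧
      (1 - γ) * n ≤ ((M.biUnion id).card : ℝ) := by
  classical
  set A := univ.filter fun x : Fin m ↪ Fin n => ∃ T : Finset (Fin m), T.card = l ∧
      (hDeg (hPull k H x) T : ℝ) < b with hA
  have hm' : (0 : ℝ) < m := by exact_mod_cast hm
  have hn : (0 : ℝ) < n := lt_of_lt_of_le (by positivity) hmn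
  obtain ⟨x, hx, hcount⟩ := exists_disjoint_blocks (α := Fin n) m (n / m)
    (by simpa using Nat.div_mul_le_self n m) A
  have hgood : ∀ j ∈ univ.filter (fun j => x j ∉ A), ∃ M, HyperPM (hPull k H (x j)) M := by
    intro j hj
    refine exists_hyperPM_of_diracT_le hl _ (fun e he => (mem_filter.mp he).2.1) fun T hT => ?_
    by_contra hlt
    refine (mem_filter.mp hj).2 (mem_filter.mpr ⟨mem_univ _, T, hT, lt_trans ?_ hb⟩)
    exact_mod_cast not_le.mp hlt
  obtain ⟨M, hMH, hMd, hMc⟩ := exists_matching_of_blocks H x hx _ hgood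
  refine ⟨M, hMH, hMd, ?_⟩
  rw [hMc]
  have hsplit : (univ.filter fun j => x j ∈ A).card + (univ.filter fun j => x j ∉ A).card =
      n / m := by
    rw [Finset.card_filter_add_card_filter_not, Finset.card_univ, Fintype.card_fin]
  set g := (univ.filter fun j => x j ∉ A).card
  set w := (univ.filter fun j => x j ∈ A).card
  set q := n / m with hq
  have hq' : (n : ℝ) - m ≤ q * m := by
    have h1 : n ≤ q * m + m := by
      have := Nat.div_add_mod n m
      have := Nat.mod_lt n hm
      rw [hq, mul_comm (n / m) m]
      omega
    have : (n : ℝ) ≤ q * m + m := by exact_mod_cast h1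
    linarith
  have hwq : (w : ℝ) ≤ γ / 2 * q := by
    rw [Fintype.card_embedding_eq, Fintype.card_fin, Fintype.card_fin] at hcount
    have h1 : (n.descFactorial m : ℝ) * w ≤ q * A.card := by exact_mod_cast hcount
    have hnm : (0 : ℝ) < (n : ℝ) ^ m := pow_pos hn m
    have h2 : (n.descFactorial m : ℝ) * w ≤ n.descFactorial m * (γ / 2 * q) := by
      calc _ ≤ _ := h1
        _ ≤ (q : ℝ) * (γ / 4 * (n : ℝ) ^ m) := by gcongr
        _ ≤ (q : ℝ) * (γ / 4 * (2 * n.descFactorial m)) := by gcongr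
        _ = _ := by ring
    exact le_of_mul_le_mul_left h2 (by linarith)
  have hgq : (1 - γ / 2) * q ≤ (g : ℝ) := by
    have : (w : ℝ) + g = q := by exact_mod_cast hsplit
    linarith
  have h3 : 2 * (m : ℝ) ≤ γ * n := by
    rw [div_le_iff₀ hγ] at hmn; linarith
  push_cast
  calc (1 - γ) * (n : ℝ) ≤ (1 - γ / 2) * (n - m) := by nlinarith
    _ ≤ (1 - γ / 2) * (q * m) := mul_le_mul_of_nonneg_left hq' (by linarith)
    _ = (1 - γ / 2) * q * m := by ring
    _ ≤ g * m := by gcongr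

/-- Almost-perfect matchings from almost-everywhere large `ℓ`-degrees: for `1 ≤ ℓ < k` and
`γ, ε > 0` there are `δ > 0` and `n₀` such that if all but at most `δ C(n,ℓ)` of the
`ℓ`-sets of an `n`-vertex `k`-uniform hypergraph (`n ≥ n₀`) have degree at least
`(δ⁺_{ℓ,k} + ε/2) C(n,k-ℓ)`, then the hypergraph has a matching covering `(1-γ)n` vertices. -/
theorem statement9 :
    ∀ k l : ℕ, 1 ≤ l → l < k → ∀ γ ε : ℝ, 0 < γ → 0 < ε →
    ∃ δ : ℝ, 0 < δ ∧ ∃ n₀ : ℕ, ∀ n : ℕ, n₀ ≤ n →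
    ∀ H : Finset (Finset (Fin n)), (∀ e ∈ H, e.card = k) →
    ((((Finset.univ.powersetCard l).filter (fun S : Finset (Fin n) =>
        (hDeg H S : ℝ) < (diracThreshold k l + ε / 2) * (n.choose (k - l) : ℝ))).card : ℝ)
      ≤ δ * (n.choose l : ℝ)) →
    ∃ M : Finset (Finset (Fin n)), M ⊆ H ∧ (M : Set (Finset (Fin n))).PairwiseDisjoint id ∧
      (1 - γ) * n ≤ ((M.biUnion id).card : ℝ) := by
  intro k l hl hlk γ ε hγ hε
  obtain ⟨r, rfl⟩ := Nat.exists_eq_add_of_lt hlk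
  rw [show l + r + 1 - l = r + 1 by omega]
  set k := l + r + 1 with hk
  have hkl : k - l = r + 1 := by omega
  rcases lt_or_ge 1 γ with hγ1 | hγ1
  · refine ⟨1, one_pos, 0, fun n _ H _ _ => ⟨∅, by simp, by simp, ?_⟩⟩
    have : (0 : ℝ) ≤ n := Nat.cast_nonneg n
    simp only [biUnion_empty, card_empty, Nat.cast_zero]
    nlinarith
  set a : ℝ := diracThreshold k l + ε / 2 with ha
  set R : ℝ := (r : ℝ) + 1 with hR
  have hR1 : 1 ≤ R := by rw [hR]; have : (0 : ℝ) ≤ r := Nat.cast_nonneg r; linarith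
  obtain ⟨μ, hμ, hμR, hμε⟩ : ∃ μ : ℝ, 0 < μ ∧ μ * R ≤ 1 ∧ μ * R ^ 2 ≤ ε / 16 := by
    refine ⟨min (1 / R) (ε / 16 / R ^ 2), by positivity, ?_, ?_⟩
    · calc _ ≤ 1 / R * R := by gcongr; exact min_le_left _ _
        _ = 1 := by field_simp
    · calc _ ≤ ε / 16 / R ^ 2 * R ^ 2 := by gcongr; exact min_le_right _ _
        _ = _ := by field_simp
  obtain ⟨m, hkm, hmk, hdirac, hratio, hexp⟩ :=
    exists_block_size k l hlk γ ε a (μ * (ε / 16)) hγ hε (by positivity)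
  rw [hkl] at hdirac hratio
  have hm : 0 < m := by omega
  have hm' : (0 : ℝ) < m := by exact_mod_cast hm
  have hl' : (0 : ℝ) < l := by exact_mod_cast hl
  have hev : ∀ᶠ n : ℕ in Filter.atTop, (n : ℝ) ^ m ≤ 2 * n.descFactorial m ∧
      a - ε / 16 ≤ a * ((n.descFactorial (r + 1) : ℝ) / (n : ℝ) ^ (r + 1)) := by
    have h1 := tendsto_descFactorial_div_pow m
    have h2 := (tendsto_descFactorial_div_pow (r + 1)).const_mul a
    rw [mul_one] at h2
    filter_upwards [h1.eventually (eventually_gt_nhds (show (1 / 2 : ℝ) < 1 by norm_num)),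
      h2.eventually (eventually_gt_nhds (show a - ε / 16 < a by linarith)),
      Filter.eventually_gt_atTop 0] with n h3 h4 h5
    have hpos : (0 : ℝ) < (n : ℝ) ^ m := pow_pos (by exact_mod_cast h5) m
    rw [lt_div_iff₀ hpos] at h3
    exact ⟨by linarith, h4.le⟩
  obtain ⟨n₁, hn₁⟩ := Filter.eventually_atTop.mp hev
  refine ⟨γ / 8 / ((m : ℝ) ^ l * (l : ℝ) ^ l), by positivity,
    max (max n₁ 1) ⌈2 * (m : ℝ) / γ⌉₊, ?_⟩
  intro n hn H hH hB
  obtain ⟨hdesc, hmean⟩ := hn₁ n (by omega)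
  have hn0 : 0 < n := by omega
  have hC : (0 : ℝ) < m.choose (r + 1) := by exact_mod_cast Nat.choose_pos (by omega)
  have hcm : (m : ℝ) * ((m - 1).choose r : ℕ) = R * m.choose (r + 1) := by
    have h := Nat.add_one_mul_choose_eq (m - 1) r
    rw [Nat.sub_add_cancel hm] at h
    rw [hR, mul_comm (_ + _)]
    exact_mod_cast h
  have hlamc : μ * m / m.choose (r + 1) * ((m - 1).choose (r + 1 - 1) : ℕ) = μ * R := by
    rw [Nat.add_sub_cancel, div_mul_eq_mul_div, mul_assoc, hcm]
    field_simp
  have hbad := card_bad_embeddings_le (l := l) (r := r + 1) (m := m) hn0 (by omega) H hH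
    (a * (n.choose (r + 1) : ℝ)) ((a - ε / 8) * m.choose (r + 1))
    ((diracThreshold k l + ε / 4) * m.choose (r + 1)) (μ * m / m.choose (r + 1))
    (γ / 8 / ((m : ℝ) ^ l * (l : ℝ) ^ l)) (Real.exp (-(μ * (ε / 16)) * m))
    (by positivity) (by positivity) (by rw [hlamc]; exact hμR) ?_ ?_ hB
  · refine exists_large_matching (k := k) (l := l) (by omega) hm γ hγ hγ1
      ((Nat.le_ceil _).trans (by exact_mod_cast (le_max_right _ _).trans hn)) H _ hdirac hdesc
      (hbad.trans ?_)
    gcongr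
    calc _ = γ / 8 + (m : ℝ) ^ l * Real.exp (-(μ * (ε / 16)) * m) := by
          field_simp
      _ ≤ γ / 4 := by linarith
  · refine hratio.trans ?_
    rw [mul_comm]
    gcongr
    refine hmean.trans (le_of_eq ?_)
    rw [Nat.descFactorial_eq_factorial_mul_choose]
    push_cast
    ring
  · rw [Real.exp_le_exp, hlamc]
    have h1 : μ * m / m.choose (r + 1) * ((diracThreshold k l + ε / 4) * m.choose (r + 1) -
        (a - ε / 8) * m.choose (r + 1)) = -(μ * m * (ε / 8)) := by
      rw [ha]
      field_simp
      ring
    rw [h1]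
    have h2 : (m : ℝ) * (μ * R) ^ 2 = μ * m * (μ * R ^ 2) := by ring
    rw [h2]
    have h3 : μ * m * (μ * R ^ 2) ≤ μ * m * (ε / 16) := by gcongr
    linarith
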